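/- Let K be a field, m, n positive integers, and M a thin representation of the equioriented commutative grid G_{m,n}. Suppose there exist vertices x ≤ z in Fin m × Fin n with M(x) ≠ 0, M(z) ≠ 0, and M(x≤z) = 0. Then M is decomposable: M is isomorphic to a pointwise direct sum of two nonzero representations. -/

import Mathlib

open Classical

structure PRep (K : Type) [Field K] (P : Type) [PartialOrder P] : Type 1 where
  V : P → Type
  [isAddCommGroup : ∀ x, AddCommGroup (V x)]
  [isModule : ∀ x, Module K (V x)]
  [isFinite : ∀ x, Module.Finite K (V x)]
  map : ∀ {x y : P}, x ≤ y → (V x →ₗ[K] V y)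
  map_refl : ∀ x : P, map (le_refl x) = LinearMap.id
  map_trans : ∀ {x y z : P} (hxy : x ≤ y) (hyz : y ≤ z),
    map (le_trans hxy hyz) = (map hyz).comp (map hxy)

attribute [instance] PRep.isAddCommGroup PRep.isModule PRep.isFinite

variable {K : Type} [Field K] {P : Type} [PartialOrder P]

namespace PRep

/-- Isomorphism of representations. -/
def Iso (M N : PRep K P) : Prop :=
  ∃ e : ∀ x : P, M.V x ≃ₗ[K] N.V x,
    ∀ (x y : P) (h : x ≤ y),
      (N.map h).comp (e x : M.V x →ₗ[K] N.V x)
        = (e y : M.V y →ₗ[K] N.V y).comp (M.map h)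

/-- Pointwise direct sum of two representations. -/
def dsum (M N : PRep K P) : PRep K P where
  V x := M.V x × N.V x
  map h := (M.map h).prodMap (N.map h)
  map_refl x := by
    apply LinearMap.ext; intro v
    simp [M.map_refl, N.map_refl]
  map_trans hxy hyz := by
    apply LinearMap.ext; intro v
    simp [M.map_trans hxy hyz, N.map_trans hxy hyz]

def IsThin (M : PRep K P) : Prop := ∀ x : P, Module.finrank K (M.V x) ≤ 1

def supp (M : PRep K P) : Set P := {x : P | Nontrivial (M.V x)}

def Indecomposable (M : PRep K P) : Prop :=
  (∃ x : P, Nontrivial (M.V x)) ∧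
  ∀ N₁ N₂ : PRep K P, M.Iso (N₁.dsum N₂) →
    (∀ x : P, Subsingleton (N₁.V x)) ∨ (∀ x : P, Subsingleton (N₂.V x))

end PRep

/-- Convexity of a subset of a poset. -/
def IsConvexSet (I : Set P) : Prop :=
  ∀ ⦃a b c : P⦄, a ∈ I → c ∈ I → a ≤ b → b ≤ c → b ∈ I

/-- Connectedness of a subset of a poset. -/
def IsConnectedSet (I : Set P) : Prop :=
  ∀ a ∈ I, ∀ b ∈ I,
    Relation.ReflTransGen (fun u v : P => u ∈ I ∧ v ∈ I ∧ (u ≤ v ∨ v ≤ u)) a b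

/-- An interval of a poset: nonempty, convex and connected subset. -/
def IsIntervalSet (I : Set P) : Prop :=
  I.Nonempty ∧ IsConvexSet I ∧ IsConnectedSet I

/-- The interval representation associated to a convex subset `I`. -/
noncomputable def intervalRep (K : Type) [Field K] {P : Type} [PartialOrder P]
    (I : Set P) (hI : IsConvexSet I) : PRep K P where
  V x := ↥(if x ∈ I then (⊤ : Submodule K K) else ⊥)
  map {x y} h :=
    { toFun := fun v => ⟨if y ∈ I then (v : K) else 0, by
        by_cases hy : y ∈ I <;> simp only [hy, if_true, if_false, Submodule.mem_top, Submodule.zero_mem]⟩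
      map_add' := fun v w => by
        apply Subtype.ext
        by_cases hy : y ∈ I <;> simp [hy]
      map_smul' := fun c v => by
        apply Subtype.ext
        by_cases hy : y ∈ I <;> simp [hy] }
  map_refl x := by
    apply LinearMap.ext; intro v
    apply Subtype.ext
    by_cases hx : x ∈ I
    · simp [hx]
    · have hv0 : (v : K) = 0 := by simpa only [hx, if_false, Submodule.mem_bot] using v.2
      show (if x ∈ I then (v : K) else 0) = (v : K)
      exact (if_neg hx).trans hv0.symm
  map_trans {x y z} hxy hyz := by
    apply LinearMap.ext; intro v
    apply Subtype.ext
    by_cases hz : z ∈ I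
    · by_cases hy : y ∈ I
      · show (if z ∈ I then (v : K) else 0)
          = (if z ∈ I then (if y ∈ I then (v : K) else 0) else 0)
        exact (if_pos hz).trans ((if_pos hz).trans (if_pos hy)).symm
      · by_cases hx : x ∈ I
        · exact absurd (hI hx hz hxy hyz) hy
        · have hv0 : (v : K) = 0 := by simpa only [hx, if_false, Submodule.mem_bot] using v.2
          simp [hz, hy, hv0]
    · simp [hz]

namespace PRep

def IsPreInterval (M : PRep K P) : Prop :=
  M.IsThin ∧ IsIntervalSet M.supp ∧
    ∀ (x y : P) (h : x ≤ y), x ∈ M.supp → y ∈ M.supp → M.map h ≠ 0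

end PRep

/-- A family of points whose consecutive members are comparable and which has no chords cannot
close up to a cycle of length at least five in a product of two linear orders. -/
theorem false_of_chordless_cycle {α β : Type*} [LinearOrder α] [LinearOrder β] {n : ℕ}
    (hn : 4 ≤ n) (f : ℕ → α × β)
    (hstep : ∀ i < n, f i ≤ f (i + 1) ∨ f (i + 1) ≤ f i)
    (hchord : ∀ i j, i + 2 ≤ j → j ≤ n → j - i < n → ¬ f i ≤ f j ∧ ¬ f j ≤ f i)
    (hclose : f 0 ≤ f n) : False := by
  have h01 : f 0 ≤ f 1 := (hstep 0 (by omega)).resolve_right fun h =>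
    (hchord 1 n (by omega) le_rfl (by omega)).1 (h.trans hclose)
  have h21 : f 2 ≤ f 1 := (hstep 1 (by omega)).resolve_left fun h =>
    (hchord 0 2 (by omega) (by omega) (by omega)).1 (h01.trans h)
  have hlast : f (n - 1) ≤ f n := by
    have h := hstep (n - 1) (by omega)
    rw [Nat.sub_add_cancel (by omega)] at h
    exact h.resolve_right fun h =>
      (hchord 0 (n - 1) (by omega) (by omega) (by omega)).1 (hclose.trans h)
  obtain rfl | hn5 : n = 4 ∨ 5 ≤ n := by omega
  · rcases hstep 2 (by omega) with h | h
    · exact (hchord 2 4 (by omega) (by omega) (by omega)).1 (h.trans hlast)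
    · exact (hchord 1 3 (by omega) (by omega) (by omega)).2 (h.trans h21)
  -- Apart from its two neighbours, all points lie on the same side of `f 0`.
  have hside : ∀ i, 2 ≤ i → i ≤ n - 1 → ((f 0).1 < (f i).1 ↔ (f 0).1 < (f 2).1) := by
    intro i hi
    induction i, hi using Nat.le_induction with
    | base => intro _; rfl
    | succ i hi ih =>
      intro hin
      rw [← ih (by omega)]
      have h1 := hchord 0 i (by omega) (by omega) (by omega)
      have h2 := hchord 0 (i + 1) (by omega) (by omega) (by omega)
      have h3 := hstep i (by omega)
      clear hstep hchord ih hlast h01 h21 hclose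
      simp only [Prod.le_def] at h1 h2 h3
      grind
  have hs := hside (n - 1) (by omega) le_rfl
  have h1 := hchord 0 2 (by omega) (by omega) (by omega)
  have h2 := hchord 0 (n - 1) (by omega) (by omega) (by omega)
  have h3 := hchord 2 (n - 1) (by omega) (by omega) (by omega)
  have h4 := hchord 2 n (by omega) (by omega) (by omega)
  have h5 := hchord 1 (n - 1) (by omega) (by omega) (by omega)
  clear hstep hchord hside
  simp only [Prod.le_def] at h1 h2 h3 h4 h5 h01 h21 hlast hclose
  grind

/-- Let `R` be a transitive subrelation of the order on a product of two chains
which is inherited by intermediate points. Then comparable points joined by an `R`-zigzag are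
`R`-related. -/
theorem rel_or_rel_of_zigzag {α β : Type*} [LinearOrder α] [LinearOrder β]
    {R : α × β → α × β → Prop} (hle : ∀ {a b}, R a b → a ≤ b)
    (htrans : ∀ {a b c}, R a b → R b c → R a c)
    (hmid : ∀ {a b c}, R a b → a ≤ c → c ≤ b → R a c ∧ R c b) (n : ℕ) :
    ∀ f : ℕ → α × β, 0 < n → (∀ i < n, R (f i) (f (i + 1)) ∨ R (f (i + 1)) (f i)) →
      (f 0 ≤ f n ∨ f n ≤ f 0) → R (f 0) (f n) ∨ R (f n) (f 0) := by
  induction n using Nat.strong_induction_on with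
  | _ n ih =>
  intro f hn hstep hcomp
  wlog h0n : f 0 ≤ f n generalizing f
  · have := this (fun i => f (n - i)) (fun i hi => by
      have := hstep (n - (i + 1)) (by omega)
      rw [show n - (i + 1) + 1 = n - i by omega] at this
      exact this.symm) (by simpa using hcomp.symm)
      (by simpa using hcomp.resolve_left h0n)
    simpa [or_comm] using this
  by_cases hchord : ∀ i j, i + 2 ≤ j → j ≤ n → j - i < n → ¬ f i ≤ f j ∧ ¬ f j ≤ f i
  · obtain rfl | rfl | rfl | hn4 : n = 1 ∨ n = 2 ∨ n = 3 ∨ 4 ≤ n := by omega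
    · exact hstep 0 (by omega)
    · left
      rcases hstep 0 (by omega) with h | h <;> rcases hstep 1 (by omega) with h' | h'
      · exact htrans h h'
      · exact (hmid h h0n (hle h')).1
      · exact (hmid h' (hle h) h0n).2
      · have h20 := htrans h' h
        have heq : f 0 = f 2 := le_antisymm h0n (hle h20)
        rw [heq] at h20 ⊢
        exact h20
    · have h01 : R (f 0) (f 1) := (hstep 0 (by omega)).resolve_right fun h =>
        (hchord 1 3 (by omega) (by omega) (by omega)).1 ((hle h).trans h0n)
      have h21 : R (f 2) (f 1) := (hstep 1 (by omega)).resolve_left fun h =>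
        (hchord 0 2 (by omega) (by omega) (by omega)).1 ((hle h01).trans (hle h))
      have h23 : R (f 2) (f 3) := (hstep 2 (by omega)).resolve_right fun h =>
        (hchord 0 2 (by omega) (by omega) (by omega)).1 (h0n.trans (hle h))
      left
      exact htrans (hmid h01 (le_inf (hle h01) h0n) inf_le_left).1
        (hmid h23 (le_inf (hle h21) (hle h23)) inf_le_right).2
    · exact (false_of_chordless_cycle hn4 f
        (fun i hi => (hstep i hi).imp hle hle) hchord h0n).elim
  · push Not at hchord
    obtain ⟨i, j, hij, hjn, hlt, hc⟩ := hchord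
    have hR : R (f i) (f j) ∨ R (f j) (f i) := by
      have := ih (j - i) hlt (fun k => f (i + k)) (by omega)
        (fun k hk => hstep (i + k) (by omega))
        (by rw [Nat.add_sub_cancel' (by omega)]; exact or_iff_not_imp_left.2 hc)
      rwa [Nat.add_sub_cancel' (by omega)] at this
    -- Replace the segment of the zigzag between `i` and `j` by a single step.
    have := ih (n - (j - i - 1)) (by omega)
      (fun k => if k ≤ i then f k else f (k + (j - i - 1))) (by omega)
      (fun k hk => by
        rcases lt_trichotomy k i with h | rfl | h
        · simpa [h.le, Nat.succ_le_of_lt h] using hstep k (by omega)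
        · simpa [show k + 1 + (j - k - 1) = j by omega] using hR
        · simpa [show ¬ k ≤ i by omega, show ¬ k + 1 ≤ i by omega,
            show k + 1 + (j - i - 1) = k + (j - i - 1) + 1 by omega] using
            hstep (k + (j - i - 1)) (by omega))
    simp only [Nat.zero_le, if_true, show ¬ n - (j - i - 1) ≤ i by omega, if_false,
      show n - (j - i - 1) + (j - i - 1) = n by omega] at this
    exact this hcomp

/-- A reflexive-transitive chain can be indexed by natural numbers. -/
theorem Relation.ReflTransGen.exists_chain {α : Type*} {r : α → α → Prop} {a b : α}
    (h : Relation.ReflTransGen r a b) :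
    ∃ (n : ℕ) (f : ℕ → α), f 0 = a ∧ f n = b ∧ ∀ i < n, r (f i) (f (i + 1)) := by
  induction h using Relation.ReflTransGen.head_induction_on with
  | refl => exact ⟨0, fun _ => b, rfl, rfl, by simp⟩
  | @head a c hac _ ih =>
    obtain ⟨n, f, rfl, hfn, hf⟩ := ih
    refine ⟨n + 1, fun | 0 => a | i + 1 => f i, rfl, hfn, ?_⟩
    rintro (_ | i) hi
    · exact hac
    · exact hf i (by omega)

namespace PRep

/-- The subrepresentation given by a family of subspaces stable under the structure maps. -/
def sub (M : PRep K P) (W : ∀ a, Submodule K (M.V a))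
    (hW : ∀ {a b : P} (h : a ≤ b), ∀ v ∈ W a, M.map h v ∈ W b) : PRep K P where
  V a := W a
  map h := (M.map h).restrict (hW h)
  map_refl a := by
    ext v
    simp [M.map_refl]
  map_trans hab hbc := by
    ext v
    simp [M.map_trans hab hbc]

theorem iso_dsum_sub (M : PRep K P) (W W' : ∀ a, Submodule K (M.V a))
    (hW : ∀ {a b : P} (h : a ≤ b), ∀ v ∈ W a, M.map h v ∈ W b)
    (hW' : ∀ {a b : P} (h : a ≤ b), ∀ v ∈ W' a, M.map h v ∈ W' b)
    (hc : ∀ a, IsCompl (W a) (W' a)) : M.Iso ((M.sub W hW).dsum (M.sub W' hW')) := by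
  let E := fun a => Submodule.prodEquivOfIsCompl (W a) (W' a) (hc a)
  refine ⟨fun a => (E a).symm, fun a b h => LinearMap.ext fun v => ?_⟩
  obtain ⟨w, rfl⟩ := (E a).surjective v
  change ((M.sub W hW).dsum (M.sub W' hW')).map h ((E a).symm (E a w)) =
    (E b).symm (M.map h (E a w))
  refine (congrArg _ ((E a).symm_apply_apply w)).trans ((E b).eq_symm_apply.2 ?_)
  exact ((M.map h).map_add w.1 w.2).symm

/-- The relation that the structure map between two comparable points is nonzero. -/
def MapNeZero (M : PRep K P) (a b : P) : Prop := ∃ h : a ≤ b, M.map h ≠ 0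

theorem MapNeZero.of_le_of_le {M : PRep K P} {a b c : P} (h : M.MapNeZero a b) (hac : a ≤ c)
    (hcb : c ≤ b) : M.MapNeZero a c ∧ M.MapNeZero c b := by
  obtain ⟨hab, hne⟩ := h
  rw [M.map_trans hac hcb] at hne
  exact ⟨⟨hac, fun h => hne (by rw [h, LinearMap.comp_zero])⟩,
    ⟨hcb, fun h => hne (by rw [h, LinearMap.zero_comp])⟩⟩

theorem IsThin.mapNeZero_trans {M : PRep K P} (hM : M.IsThin) {a b c : P}
    (hab : M.MapNeZero a b) (hbc : M.MapNeZero b c) : M.MapNeZero a c := by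
  obtain ⟨hab, hne⟩ := hab
  obtain ⟨hbc, hne'⟩ := hbc
  refine ⟨hab.trans hbc, fun h => hne' ?_⟩
  rw [M.map_trans hab hbc] at h
  obtain ⟨v, hv⟩ := DFunLike.ne_iff.1 hne
  obtain ⟨u, hu⟩ := finrank_le_one_iff.1 (hM b)
  obtain ⟨c₀, hc₀⟩ := hu (M.map hab v)
  have hc₀' : c₀ ≠ 0 := by
    rintro rfl
    exact hv (by simp [← hc₀])
  have hgu : M.map hbc u = 0 := by
    have hcv : M.map hbc (M.map hab v) = 0 := LinearMap.congr_fun h v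
    rw [← hc₀, map_smul] at hcv
    exact (smul_eq_zero.1 hcv).resolve_left hc₀'
  apply LinearMap.ext
  intro w
  obtain ⟨d, rfl⟩ := hu w
  simp [hgu]

/-- A set of points which is a union of connected components, with respect to the nonzero structure
maps, splits off a direct summand. -/
theorem exists_iso_dsum_of_mapNeZero_iff (M : PRep K P) (S : Set P)
    (hS : ∀ a b, M.MapNeZero a b → (a ∈ S ↔ b ∈ S)) {x z : P} (hx : Nontrivial (M.V x))
    (hz : Nontrivial (M.V z)) (hxS : x ∈ S) (hzS : z ∉ S) :
    ∃ N₁ N₂ : PRep K P, (∃ a, Nontrivial (N₁.V a)) ∧ (∃ a, Nontrivial (N₂.V a)) ∧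
      M.Iso (N₁.dsum N₂) := by
  have stable : ∀ T : Set P, (∀ a b, M.MapNeZero a b → (a ∈ T ↔ b ∈ T)) →
      ∀ {a b : P} (h : a ≤ b), ∀ v ∈ (if a ∈ T then ⊤ else ⊥ : Submodule K (M.V a)),
        M.map h v ∈ (if b ∈ T then ⊤ else ⊥ : Submodule K (M.V b)) := by
    intro T hT a b h v hv
    by_cases h0 : M.map h = 0
    · simp [h0]
    · have hab := hT a b ⟨h, h0⟩
      by_cases hb : b ∈ T
      · simp [hb]
      · rw [if_neg (mt hab.1 hb), Submodule.mem_bot] at hv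
        simp [hv]
  have top : ∀ {a} {W : Submodule K (M.V a)}, W = ⊤ → Nontrivial (M.V a) → Nontrivial W := by
    rintro a _ rfl _
    exact Submodule.topEquiv.toEquiv.nontrivial
  refine ⟨M.sub _ (stable S hS), M.sub _ (stable Sᶜ fun a b h => not_congr (hS a b h)),
    ⟨x, top (if_pos hxS) hx⟩, ⟨z, top (if_pos hzS) hz⟩, M.iso_dsum_sub _ _ _ _ fun a => ?_⟩
  by_cases ha : a ∈ S
  · simpa [ha] using isCompl_top_bot
  · simpa [ha] using isCompl_bot_top

end PRep

/-- A thin representation of the grid having two nonzero spaces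
connected by a zero map is decomposable into a direct sum of two nonzero
representations. -/
theorem thin_with_zero_map_decomposable (K : Type) [Field K] (m n : ℕ)
    (hm : 0 < m) (hn : 0 < n) (M : PRep K (Fin m × Fin n))
    (hthin : M.IsThin) (x z : Fin m × Fin n) (hxz : x ≤ z)
    (hx : Nontrivial (M.V x)) (hz : Nontrivial (M.V z))
    (h0 : M.map hxz = 0) :
    ∃ N₁ N₂ : PRep K (Fin m × Fin n),
      (∃ a, Nontrivial (N₁.V a)) ∧ (∃ a, Nontrivial (N₂.V a)) ∧
        M.Iso (N₁.dsum N₂) := by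
  have hne : x ≠ z := by
    rintro rfl
    obtain ⟨v, hv⟩ := exists_ne (0 : M.V x)
    rw [M.map_refl] at h0
    exact hv (LinearMap.congr_fun h0 v)
  let r : Fin m × Fin n → Fin m × Fin n → Prop := fun a b => M.MapNeZero a b ∨ M.MapNeZero b a
  refine M.exists_iso_dsum_of_mapNeZero_iff {a | Relation.ReflTransGen r x a}
    (fun a b h => ⟨fun ha => ha.tail (Or.inl h), fun hb => hb.tail (Or.inr h)⟩) hx hz
    Relation.ReflTransGen.refl fun hmem => ?_
  obtain ⟨k, f, rfl, rfl, hf⟩ := hmem.exists_chain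
  rcases rel_or_rel_of_zigzag (R := M.MapNeZero) (fun h => h.1) hthin.mapNeZero_trans
    PRep.MapNeZero.of_le_of_le k f
    (Nat.pos_of_ne_zero fun hk => hne (by rw [hk])) hf (Or.inl hxz) with ⟨_, h⟩ | ⟨h, _⟩
  · exact h h0
  · exact hne (le_antisymm hxz h)
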